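/- Let K be a field of characteristic 0 or p ≥ 5. With P̃ := y² − (x³ + A·x + B), q̃ := a0·x² + a1·x·y + a2·x + a3·y² + a4·y + a5S and J(P,q) := (∂P̃/∂x)·(∂q̃/∂y) − (∂P̃/∂y)·(∂q̃/∂x) in K[x, y, A, B, a0, ..., a5], the elimination ideal I := (P̃, q̃, J(P,q)) ∩ K[A, B, a0, ..., a5] is contained in the ideal of K[A, B, a0, ..., a5] generated by a1 and a3. (Equivalently, the generator f2 of I lies in the ideal (a1, a3).) -/

import Mathlib

open MvPolynomial

noncomputable section

/-- Embedding of the eight parameter variables `A, B, a0, …, a5` into the ten variables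
`x, y, A, B, a0, …, a5` (with `x = 0`, `y = 1`, `A = 2`, `B = 3`, `aᵢ = i + 4`). -/
def paramEmb : Fin 8 → Fin 10 := fun i => ⟨i.val + 2, by omega⟩

/-- `P̃ = y² − (x³ + A·x + B)` in `K[x, y, A, B, a0, …, a5]`. -/
def Ptil (K : Type*) [Field K] : MvPolynomial (Fin 10) K :=
  X 1 ^ 2 - (X 0 ^ 3 + X 2 * X 0 + X 3)

/-- `q̃ = a0·x² + a1·x·y + a2·x + a3·y² + a4·y + a5` in `K[x, y, A, B, a0, …, a5]`. -/
def qtil (K : Type*) [Field K] : MvPolynomial (Fin 10) K :=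
  X 4 * X 0 ^ 2 + X 5 * X 0 * X 1 + X 6 * X 0 + X 7 * X 1 ^ 2 + X 8 * X 1 + X 9

/-- The Jacobian determinant `J(P,q) = P̃ₓ·q̃_y − P̃_y·q̃ₓ`. -/
def Jpq (K : Type*) [Field K] : MvPolynomial (Fin 10) K :=
  pderiv 0 (Ptil K) * pderiv 1 (qtil K) - pderiv 1 (Ptil K) * pderiv 0 (qtil K)

lemma Jpq_eq (K : Type*) [Field K] : Jpq K =
    (-(3 * X 0 ^ 2 + X 2)) * (X 5 * X 0 + 2 * X 7 * X 1 + X 8)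
      - 2 * X 1 * (2 * X 4 * X 0 + X 5 * X 1 + X 6) := by
  simp only [Jpq, Ptil, qtil, map_sub, map_add, Derivation.leibniz, Derivation.leibniz_pow,
    pderiv_X, smul_eq_mul, nsmul_eq_mul]
  simp
  ring

/-- Identities in a field: the curve with a point near infinity, tangent to the conic. -/
lemma field_ids {L : Type*} [Field L] (t u v d e A b a0 a2 a4 a5 : L) (ht : t ≠ 0)
    (hu : u = 1 + A * t ^ 4 + b * t ^ 6) (huv : u * v = 1)
    (hd : (3 + A * t ^ 4 * u ^ 2 - 2 * u) * d = 1)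
    (he : e = 3 + A * t ^ 4 * u ^ 2) (x y B a1 a3 r s : L)
    (hx : x = v / t ^ 2) (hy : y = v / t ^ 3)
    (hB : B = (b - A * (u + 1) * (A * t ^ 2 + b * t ^ 4)) * v ^ 3)
    (hr : r = a0 + a2 * t ^ 2 * u + a4 * t * u + a5 * t ^ 4 * u ^ 2)
    (hs : s = 4 * a0 + 2 * a2 * t ^ 2 * u + a4 * t * e)
    (h1 : a1 = t * (s * u - 2 * r * e) * d)
    (h3 : a3 = t ^ 2 * ((2 * u + e) * r - s * u) * d) :
    y ^ 2 - (x ^ 3 + A * x + B) = 0 ∧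
    a0 * x ^ 2 + a1 * x * y + a2 * x + a3 * y ^ 2 + a4 * y + a5 = 0 ∧
    (-(3 * x ^ 2 + A)) * (a1 * x + 2 * a3 * y + a4)
      - 2 * y * (2 * a0 * x + a1 * y + a2) = 0 := by
  have hu0 : u ≠ 0 := left_ne_zero_of_mul_eq_one huv
  have hD0 := left_ne_zero_of_mul_eq_one hd
  have hv : v = 1 / u := by field_simp; linear_combination huv
  obtain ⟨D, hD⟩ : ∃ D, D = 3 + A * t ^ 4 * u ^ 2 - 2 * u := ⟨_, rfl⟩
  rw [← hD] at hD0 hd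
  have hd' : d = 1 / D := by
    rw [eq_div_iff hD0]; linear_combination hd
  have he' : e = D + 2 * u := by rw [he, hD]; ring
  have hA : A = (D + 2 * u - 3) / (t ^ 4 * u ^ 2) := by
    rw [eq_div_iff (mul_ne_zero (pow_ne_zero _ ht) (pow_ne_zero _ hu0))]; linear_combination -hD
  refine ⟨?_, ?_, ?_⟩
  · have hb : b = (u - 1 - A * t ^ 4) / t ^ 6 := by
      rw [eq_div_iff (pow_ne_zero _ ht)]; linear_combination -hu
    clear hu hA he hD
    subst hx hy hB hv hb
    field_simp
    ring
  · clear hu hB huv hd he hD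
    subst hx hy h1 h3 hr hs he' hd' hv hA
    field_simp
    ring
  · clear hu hB huv hd he hD
    subst hx hy h1 h3 hr hs he' hd' hv hA
    field_simp
    ring

theorem stmt8 {K : Type*} [Field K] (hchar : ringChar K = 0 ∨ 5 ≤ ringChar K) :
    Ideal.comap (rename paramEmb : MvPolynomial (Fin 8) K →ₐ[K] MvPolynomial (Fin 10) K)
        (Ideal.span {Ptil K, qtil K, Jpq K}) ≤
      Ideal.span {(X 3 : MvPolynomial (Fin 8) K), X 5} := by
  intro f hf
  rw [Ideal.mem_comap] at hf
  let R := MvPolynomial (Fin 8) K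
  let S := PowerSeries R
  let L := FractionRing S
  let c : Fin 8 → S := fun i => PowerSeries.C (X i : R)
  let t : S := PowerSeries.X
  have hct : PowerSeries.constantCoeff t = 0 := PowerSeries.constantCoeff_X
  have hcc : ∀ i, PowerSeries.constantCoeff (c i) = X i :=
    fun i => PowerSeries.constantCoeff_C _
  obtain ⟨u, hu⟩ : ∃ u : S, u = 1 + c 0 * t ^ 4 + c 1 * t ^ 6 := ⟨_, rfl⟩
  have hcu : PowerSeries.constantCoeff u = 1 := by simp [hu, hct]
  have hu1 : IsUnit u := by rw [PowerSeries.isUnit_iff_constantCoeff, hcu]; exact isUnit_one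
  obtain ⟨v, huv⟩ := hu1.exists_right_inv
  have hcv : PowerSeries.constantCoeff v = 1 := by
    have := congrArg PowerSeries.constantCoeff huv
    simpa [hcu] using this
  have hd1 : IsUnit (3 + c 0 * t ^ 4 * u ^ 2 - 2 * u) := by
    rw [PowerSeries.isUnit_iff_constantCoeff]
    have : PowerSeries.constantCoeff (3 + c 0 * t ^ 4 * u ^ 2 - 2 * u) = 1 := by
      simp only [map_sub, map_add, map_mul, map_pow, hct, hcu, map_ofNat]
      ring
    rw [this]; exact isUnit_one
  obtain ⟨d, hd⟩ := hd1.exists_right_inv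
  obtain ⟨e, he⟩ : ∃ e : S, e = 3 + c 0 * t ^ 4 * u ^ 2 := ⟨_, rfl⟩
  obtain ⟨r, hr⟩ : ∃ r : S, r = c 2 + c 4 * t ^ 2 * u + c 6 * t * u + c 7 * t ^ 4 * u ^ 2 :=
    ⟨_, rfl⟩
  obtain ⟨s, hs⟩ : ∃ s : S, s = 4 * c 2 + 2 * c 4 * t ^ 2 * u + c 6 * t * e := ⟨_, rfl⟩
  obtain ⟨B, hB⟩ : ∃ B : S,
    B = (c 1 - c 0 * (u + 1) * (c 0 * t ^ 2 + c 1 * t ^ 4)) * v ^ 3 := ⟨_, rfl⟩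
  obtain ⟨a1, h1⟩ : ∃ a : S, a = t * (s * u - 2 * r * e) * d := ⟨_, rfl⟩
  obtain ⟨a3, h3⟩ : ∃ a : S, a = t ^ 2 * ((2 * u + e) * r - s * u) * d := ⟨_, rfl⟩
  have hcB : PowerSeries.constantCoeff B = X 1 := by simp [hB, hct, hcv, hcc]
  have hc1 : PowerSeries.constantCoeff a1 = 0 := by simp [h1, hct]
  have hc3 : PowerSeries.constantCoeff a3 = 0 := by simp [h3, hct]
  let g : S →+* L := algebraMap S L
  have hg : Function.Injective g := IsFractionRing.injective S L
  have ht0 : g t ≠ 0 := by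
    rw [Ne, map_eq_zero_iff g hg]; exact PowerSeries.X_ne_zero
  obtain ⟨x, hx⟩ : ∃ x : L, x = g v / g t ^ 2 := ⟨_, rfl⟩
  obtain ⟨y, hy⟩ : ∃ y : L, y = g v / g t ^ 3 := ⟨_, rfl⟩
  let p : Fin 8 → S := ![c 0, B, c 2, a1, c 4, a3, c 6, c 7]
  let P : Fin 10 → L :=
    ![x, y, g (c 0), g B, g (c 2), g a1, g (c 4), g a3, g (c 6), g (c 7)]
  let k : K →+* S := PowerSeries.C.comp (C : K →+* R)
  let φ : MvPolynomial (Fin 10) K →+* L := eval₂Hom (g.comp k) P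
  have hX : ∀ i, φ (X i) = P i := fun i => eval₂Hom_X' _ _ _
  have g2 : g 2 = 2 := map_ofNat g 2
  have g3 : g 3 = 3 := map_ofNat g 3
  have g4 : g 4 = 4 := map_ofNat g 4
  obtain ⟨i1, i2, i3⟩ := field_ids (g t) (g u) (g v) (g d) (g e) (g (c 0)) (g (c 1)) (g (c 2))
    (g (c 4)) (g (c 6)) (g (c 7)) ht0 (by simp [hu]) (by rw [← map_mul, huv, map_one])
    (by rw [← map_one g, ← hd]; simp [g2, g3]) (by simp [he, g3]) x y (g B) (g a1) (g a3) (g r) (g s) hx hy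
    (by simp [hB]) (by simp [hr]) (by simp [hs, g2, g4]) (by simp [h1, g2]) (by simp [h3, g2])
  have hker : Ideal.span {Ptil K, qtil K, Jpq K} ≤ RingHom.ker φ := by
    rw [Ideal.span_le]
    rintro z (rfl | rfl | rfl)
    · rw [SetLike.mem_coe, RingHom.mem_ker, ← i1]
      simp only [Ptil, map_sub, map_add, map_mul, map_pow, hX]
      rfl
    · rw [SetLike.mem_coe, RingHom.mem_ker, ← i2]
      simp only [qtil, map_add, map_mul, map_pow, hX]
      rfl
    · rw [SetLike.mem_coe, RingHom.mem_ker, ← i3, Jpq_eq]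
      simp only [map_sub, map_neg, map_add, map_mul, map_pow, hX, map_ofNat]
      rfl
  have h0 : φ (rename paramEmb f) = 0 := hker hf
  have hcomp : φ (rename paramEmb f) = g (eval₂Hom k p f) := by
    have : φ.comp (rename paramEmb : R →ₐ[K] _).toRingHom = g.comp (eval₂Hom k p) := by
      apply MvPolynomial.ringHom_ext
      · intro a
        simp [φ]
      · intro i
        simp only [RingHom.comp_apply, AlgHom.toRingHom_eq_coe, RingHom.coe_coe, rename_X, hX,
          eval₂Hom_X']
        fin_cases i <;> rfl
    exact congrArg (fun h => h f) this
  have h2 : eval₂Hom k p f = 0 := hg (by rw [← hcomp, h0, map_zero])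
  -- reduce modulo the ideal
  let I : Ideal R := Ideal.span {(X 3 : R), X 5}
  have h4 : (Ideal.Quotient.mk I).comp ((PowerSeries.constantCoeff).comp (eval₂Hom k p))
      = Ideal.Quotient.mk I := by
    have m3 : Ideal.Quotient.mk I (X 3) = 0 :=
      Ideal.Quotient.eq_zero_iff_mem.2 (Ideal.subset_span (by simp))
    have m5 : Ideal.Quotient.mk I (X 5) = 0 :=
      Ideal.Quotient.eq_zero_iff_mem.2 (Ideal.subset_span (by simp))
    apply MvPolynomial.ringHom_ext
    · intro a
      simp [k]
    · intro i
      simp only [RingHom.comp_apply, eval₂Hom_X']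
      fin_cases i <;> simp [p, hcc, hcB, hc1, hc3, m3, m5]
  have h5 := congrArg (fun h => h f) h4
  simp only [RingHom.comp_apply, h2, map_zero] at h5
  exact Ideal.Quotient.eq_zero_iff_mem.1 h5.symm

end
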